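/- arXiv:2502.09461 — 3 statements merged into one kernel-verified Lean document; each statement's English description precedes it below -/
import Mathlib

section
/- Let p = (b₁,…,bₙ) be a directed path in a finite symmetric multigraph with Dirichlet vertex set V_D. Then the sum of the scattering coefficients of all one-bond pre-extensions of p satisfies Σ_{b ∈ B, tgt(b) = src(b₁)} α(b, b₁,…,bₙ) = −α(p) if src(b₁) ∈ V_D, and = α(p) if src(b₁) ∉ V_D. Likewise, the sum over all one-bond post-extensions satisfies Σ_{b ∈ B, src(b) = tgt(bₙ)} α(b₁,…,bₙ, b) = −α(p) if tgt(bₙ) ∈ V_D, and = α(p) if tgt(bₙ) ∉ V_D. -/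
/-- A directed path in a multigraph, encoded as its first bond together with the list of
its remaining bonds; the bonds must be consecutive. -/
def IsDirPath {V B : Type*} (src tgt : B → V) (p : B × List B) : Prop :=
  List.Chain' (fun a b => tgt a = src b) (p.1 :: p.2)

/-- The final vertex of a directed path. -/
def pathEnd {V B : Type*} (tgt : B → V) (p : B × List B) : V :=
  tgt ((p.1 :: p.2).getLast (List.cons_ne_nil _ _))

/-- The degree of a vertex: the number of bonds with source `v`. -/
def degree {V B : Type*} [Fintype B] [DecidableEq V] (src : B → V) (v : V) : ℕ :=
  (Finset.univ.filter fun b => src b = v).card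

/-- The scattering factor `β(b,b′)` associated with two consecutive bonds: it equals `−1`
if `tgt b` is a Dirichlet vertex, and `2/deg(tgt b) − [b′ = rev b]` otherwise. -/
noncomputable def scatBeta {V B : Type*} [Fintype B] [DecidableEq V] [DecidableEq B]
    (src tgt : B → V) (rev : B → B) (VD : Finset V) (b b' : B) : ℝ :=
  if tgt b ∈ VD then -1
  else 2 / (degree src (tgt b) : ℝ) - (if b' = rev b then 1 else 0)

/-- The scattering coefficient `α(b₁,…,bₙ) = ∏ β(bᵢ,bᵢ₊₁)` of a directed path,
equal to `1` for one-bond paths. -/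
noncomputable def scatAlpha {V B : Type*} [Fintype B] [DecidableEq V] [DecidableEq B]
    (src tgt : B → V) (rev : B → B) (VD : Finset V) : B → List B → ℝ
  | _, [] => 1
  | b, b' :: l => scatBeta src tgt rev VD b b' * scatAlpha src tgt rev VD b' l

/-- Appending a bond multiplies the scattering coefficient by the factor at the final vertex. -/
theorem scatAlpha_append_singleton {V B : Type*} [Fintype B] [DecidableEq V] [DecidableEq B]
    (src tgt : B → V) (rev : B → B) (VD : Finset V) (b c : B) (l : List B) :
    scatAlpha src tgt rev VD b (l ++ [c])
      = scatAlpha src tgt rev VD b l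
        * scatBeta src tgt rev VD ((b :: l).getLast (List.cons_ne_nil _ _)) c := by
  induction l generalizing b with
  | nil => simp [scatAlpha]
  | cons d l ih => simp [scatAlpha, ih, mul_assoc]

/-- Reversal identifies the bonds ending at `v` with those starting at `v`. -/
theorem card_filter_tgt_eq_degree {V B : Type*} [Fintype B] [DecidableEq V]
    (src tgt : B → V) (rev : B → B) (hrev : ∀ b, rev (rev b) = b)
    (hsrcrev : ∀ b, src (rev b) = tgt b) (v : V) :
    (Finset.univ.filter fun b => tgt b = v).card = degree src v := by
  unfold degree
  refine Finset.card_bij' (fun b _ => rev b) (fun b _ => rev b) ?_ ?_ ?_ ?_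
  · simp [hsrcrev]
  · simp [← hsrcrev, hrev]
  · simp [hrev]
  · simp [hrev]

/-- If `s` has `degree src v` elements, one of which is `c`, then the scattering factors at `v`
indexed by `s`, with the reflected term at `c`, sum to `-1` or `1`. -/
theorem sum_scattering_factor {V B : Type*} [Fintype B] [DecidableEq V] [DecidableEq B]
    (src : B → V) (VD : Finset V) (v : V) (hVD : v ∈ VD → degree src v = 1)
    (s : Finset B) (hs : s.card = degree src v) (c : B) (hc : c ∈ s) :
    ∑ b ∈ s, (if v ∈ VD then (-1 : ℝ)
        else 2 / (degree src v : ℝ) - (if b = c then 1 else 0))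
      = if v ∈ VD then -1 else 1 := by
  split_ifs with hv
  · simp [hs, hVD hv]
  · have h : (degree src v : ℝ) ≠ 0 := by
      rw [← hs]
      exact_mod_cast (Finset.card_pos.mpr ⟨c, hc⟩).ne'
    rw [Finset.sum_sub_distrib, Finset.sum_const, hs, Finset.sum_ite_eq', if_pos hc,
      nsmul_eq_mul, mul_div_cancel₀ _ h]
    norm_num

/-- The factors of all bonds entering the initial vertex of `c` sum to `-1` or `1`. -/
theorem sum_scatBeta_left {V B : Type*} [Fintype B] [DecidableEq V] [DecidableEq B]
    (src tgt : B → V) (rev : B → B) (hrev : ∀ b, rev (rev b) = b)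
    (hsrcrev : ∀ b, src (rev b) = tgt b)
    (VD : Finset V) (hVD : ∀ v ∈ VD, degree src v = 1) (c : B) :
    ∑ b ∈ Finset.univ.filter (fun b => tgt b = src c), scatBeta src tgt rev VD b c
      = if src c ∈ VD then -1 else 1 := by
  rw [← sum_scattering_factor src VD (src c) (hVD _) _
    (card_filter_tgt_eq_degree src tgt rev hrev hsrcrev (src c)) (rev c)
    (by simp [← hsrcrev, hrev])]
  refine Finset.sum_congr rfl fun b hb => ?_
  have hcb : c = rev b ↔ b = rev c :=
    ⟨fun h => by rw [h, hrev], fun h => by rw [h, hrev]⟩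
  rw [scatBeta, (Finset.mem_filter.mp hb).2]
  simp only [hcb]

/-- The factors of all bonds leaving the final vertex of `c` sum to `-1` or `1`. -/
theorem sum_scatBeta_right {V B : Type*} [Fintype B] [DecidableEq V] [DecidableEq B]
    (src tgt : B → V) (rev : B → B) (hsrcrev : ∀ b, src (rev b) = tgt b)
    (VD : Finset V) (hVD : ∀ v ∈ VD, degree src v = 1) (c : B) :
    ∑ b ∈ Finset.univ.filter (fun b => src b = tgt c), scatBeta src tgt rev VD c b
      = if tgt c ∈ VD then -1 else 1 :=
  sum_scattering_factor src VD (tgt c) (hVD _) _ rfl (rev c) (by simp [hsrcrev])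

/-- The sum of the scattering coefficients of all one-bond pre-extensions (resp.
post-extensions) of a directed path `p` equals `−α(p)` if the initial (resp. final)
vertex of `p` lies in the Dirichlet set `V_D`, and `α(p)` otherwise. -/
theorem scattering_coefficient_dual {V B : Type*} [Fintype V] [Fintype B]
    [DecidableEq V] [DecidableEq B]
    (src tgt : B → V) (rev : B → B)
    (hrev : ∀ b, rev (rev b) = b) (hfpf : ∀ b, rev b ≠ b)
    (hsrcrev : ∀ b, src (rev b) = tgt b)
    (VD : Finset V) (hVD : ∀ v ∈ VD, degree src v = 1)
    (p : B × List B) (hp : IsDirPath src tgt p) :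
    (∑ b ∈ Finset.univ.filter (fun b => tgt b = src p.1),
        scatAlpha src tgt rev VD b (p.1 :: p.2))
      = (if src p.1 ∈ VD then -1 else 1) * scatAlpha src tgt rev VD p.1 p.2 ∧
    (∑ b ∈ Finset.univ.filter (fun b => src b = pathEnd tgt p),
        scatAlpha src tgt rev VD p.1 (p.2 ++ [b]))
      = (if pathEnd tgt p ∈ VD then -1 else 1) * scatAlpha src tgt rev VD p.1 p.2 := by
  constructor
  · simp only [scatAlpha]
    rw [← Finset.sum_mul, sum_scatBeta_left src tgt rev hrev hsrcrev VD hVD]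
  · simp only [scatAlpha_append_singleton]
    rw [← Finset.mul_sum, mul_comm]
    exact congrArg (· * _) (sum_scatBeta_right src tgt rev hsrcrev VD hVD _)
end

section
/- Let E be a nonempty finite set and ℓ : E → (0,∞). Then for every t > 0, (1/√(4πt)) · Σ_{e∈E} ∫₀^{ℓ_e} ∫₀^{ℓ_e} e^{−(x−y)²/(4t)} dy dx = Σ_{e∈E} ℓ_e + (2√t/√π)·(Σ_{e∈E} e^{−ℓ_e²/(4t)} − #E) − Σ_{e∈E} ℓ_e·erfc(ℓ_e/(2√t)), and this quantity also equals Σ_{e∈E} ℓ_e − (2√t/√π)·#E + 2√t·Σ_{e∈E} H(ℓ_e/(2√t)). -/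
open MeasureTheory

/-- The complementary error function `erfc(x) = (2/√π) ∫_x^∞ e^{−s²} ds`. -/
noncomputable def erfc (x : ℝ) : ℝ :=
  (2 / Real.sqrt Real.pi) * ∫ s in Set.Ioi x, Real.exp (-s ^ 2)

/-- The function `H(x) = (1/√π)·e^{−x²} − x·erfc(x)`. -/
noncomputable def H (x : ℝ) : ℝ :=
  (1 / Real.sqrt Real.pi) * Real.exp (-x ^ 2) - x * erfc x

theorem integrable_exp_neg_sq : Integrable (fun s : ℝ => Real.exp (-s ^ 2)) := by
  simpa using integrable_exp_neg_mul_sq (b := 1) one_pos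

theorem integral_exp_neg_sq : ∫ s : ℝ, Real.exp (-s ^ 2) = Real.sqrt Real.pi := by
  simpa using integral_gaussian 1

theorem hasDerivAt_erfc (x : ℝ) :
    HasDerivAt erfc (-(2 / Real.sqrt Real.pi) * Real.exp (-x ^ 2)) x := by
  have hcont : Continuous fun s : ℝ => Real.exp (-s ^ 2) := by fun_prop
  have hsplit : erfc = fun x => (2 / Real.sqrt Real.pi) *
      ((∫ s in Set.Ioi (0 : ℝ), Real.exp (-s ^ 2)) - ∫ s in (0 : ℝ)..x, Real.exp (-s ^ 2)) := by
    funext x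
    rw [erfc, ← intervalIntegral.integral_interval_add_Ioi (a := 0) (b := x)
      integrable_exp_neg_sq.integrableOn integrable_exp_neg_sq.integrableOn]
    ring
  rw [hsplit]
  convert! ((hcont.integral_hasStrictDerivAt 0 x).hasDerivAt.const_sub
    (∫ s in Set.Ioi (0 : ℝ), Real.exp (-s ^ 2))).const_mul (2 / Real.sqrt Real.pi) using 1
  ring

theorem continuous_erfc : Continuous erfc :=
  continuous_iff_continuousAt.2 fun x => (hasDerivAt_erfc x).continuousAt

theorem erfc_neg (x : ℝ) : erfc (-x) = 2 - erfc x := by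
  have hneg : ∫ s in Set.Ioi (-x), Real.exp (-s ^ 2) = ∫ s in Set.Iic x, Real.exp (-s ^ 2) := by
    rw [← integral_comp_neg_Iic]
    exact integral_congr_ae (.of_forall fun s => congrArg (fun r => Real.exp (-r)) (neg_sq s))
  have hadd := intervalIntegral.integral_Iic_add_Ioi (b := x)
    integrable_exp_neg_sq.integrableOn integrable_exp_neg_sq.integrableOn
  rw [integral_exp_neg_sq] at hadd
  have hpi : Real.sqrt Real.pi ≠ 0 := (Real.sqrt_pos.2 Real.pi_pos).ne'
  rw [erfc, erfc, hneg, eq_sub_of_add_eq hadd]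
  field_simp

theorem H_zero : H 0 = 1 / Real.sqrt Real.pi := by
  simp [H]

theorem H_neg (x : ℝ) : H (-x) = H x + 2 * x := by
  rw [H, H, erfc_neg, neg_sq]
  ring

theorem hasDerivAt_H (x : ℝ) : HasDerivAt H (-erfc x) x := by
  have hexp := (((hasDerivAt_id x).pow 2).neg.exp).const_mul (1 / Real.sqrt Real.pi)
  convert! hexp.sub ((hasDerivAt_id x).mul (hasDerivAt_erfc x)) using 1
  simp
  ring

theorem integral_exp_neg_sub_sq_div {c : ℝ} (hc : c ≠ 0) (l x : ℝ) :
    ∫ y in (0 : ℝ)..l, Real.exp (-(x - y) ^ 2 / c ^ 2) =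
      c * Real.sqrt Real.pi / 2 * (erfc (-x / c) - erfc ((l - x) / c)) := by
  have hpi : Real.sqrt Real.pi ≠ 0 := (Real.sqrt_pos.2 Real.pi_pos).ne'
  have hderiv (y : ℝ) : HasDerivAt (fun y => -(c * Real.sqrt Real.pi / 2) * erfc ((y - x) / c))
      (Real.exp (-(x - y) ^ 2 / c ^ 2)) y := by
    convert! ((hasDerivAt_erfc ((y - x) / c)).comp y
      (((hasDerivAt_id y).sub_const x).div_const c)).const_mul
        (-(c * Real.sqrt Real.pi / 2)) using 1
    rw [show -(x - y) ^ 2 / c ^ 2 = -((y - x) / c) ^ 2 by ring]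
    field_simp
  rw [intervalIntegral.integral_eq_sub_of_hasDerivAt (fun y _ => hderiv y)
    (Continuous.intervalIntegrable (by fun_prop) _ _), zero_sub]
  ring

theorem integral_erfc_sub_div {c : ℝ} (hc : c ≠ 0) (a l : ℝ) :
    ∫ x in (0 : ℝ)..l, erfc ((a - x) / c) = c * (H ((a - l) / c) - H (a / c)) := by
  have hderiv (x : ℝ) : HasDerivAt (fun x => c * H ((a - x) / c)) (erfc ((a - x) / c)) x := by
    convert! ((hasDerivAt_H ((a - x) / c)).comp x
      (((hasDerivAt_id x).const_sub a).div_const c)).const_mul c using 1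
    field_simp
  rw [intervalIntegral.integral_eq_sub_of_hasDerivAt (fun x _ => hderiv x)
    ((continuous_erfc.comp (by fun_prop)).intervalIntegrable _ _), sub_zero]
  ring

theorem integral_integral_exp_neg_sub_sq_div {c : ℝ} (hc : c ≠ 0) (l : ℝ) :
    ∫ x in (0 : ℝ)..l, ∫ y in (0 : ℝ)..l, Real.exp (-(x - y) ^ 2 / c ^ 2) =
      c * Real.sqrt Real.pi * (l - c / Real.sqrt Real.pi + c * H (l / c)) := by
  have hint (a : ℝ) : IntervalIntegrable (fun x => erfc ((a - x) / c)) volume 0 l :=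
    (continuous_erfc.comp (by fun_prop)).intervalIntegrable _ _
  simp_rw [integral_exp_neg_sub_sq_div hc, ← zero_sub]
  rw [intervalIntegral.integral_const_mul, intervalIntegral.integral_sub (hint 0) (hint l),
    integral_erfc_sub_div hc, integral_erfc_sub_div hc, zero_sub, neg_div, H_neg, sub_self,
    zero_div, H_zero]
  field_simp
  ring

/-- The non-topological part of the heat content of a metric graph with edge set `E`
and edge lengths `ℓ_e > 0`: for every `t > 0`,
`(1/√(4πt)) Σ_e ∫₀^{ℓ_e}∫₀^{ℓ_e} e^{−(x−y)²/(4t)} dy dx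
  = Σ_e ℓ_e + (2√t/√π)(Σ_e e^{−ℓ_e²/(4t)} − #E) − Σ_e ℓ_e·erfc(ℓ_e/(2√t))`,
which also equals `Σ_e ℓ_e − (2√t/√π)·#E + 2√t·Σ_e H(ℓ_e/(2√t))`. -/
theorem nontopological_heat_content
    {E : Type*} [Fintype E] [Nonempty E] (ℓ : E → ℝ) (hℓ : ∀ e, 0 < ℓ e)
    (t : ℝ) (ht : 0 < t) :
    (1 / Real.sqrt (4 * Real.pi * t))
        * (∑ e : E, ∫ x in (0 : ℝ)..(ℓ e), ∫ y in (0 : ℝ)..(ℓ e),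
            Real.exp (-(x - y) ^ 2 / (4 * t)))
      = (∑ e : E, ℓ e)
        + (2 * Real.sqrt t / Real.sqrt Real.pi)
            * ((∑ e : E, Real.exp (-(ℓ e) ^ 2 / (4 * t))) - Fintype.card E)
        - ∑ e : E, ℓ e * erfc (ℓ e / (2 * Real.sqrt t)) ∧
    (1 / Real.sqrt (4 * Real.pi * t))
        * (∑ e : E, ∫ x in (0 : ℝ)..(ℓ e), ∫ y in (0 : ℝ)..(ℓ e),
            Real.exp (-(x - y) ^ 2 / (4 * t)))
      = (∑ e : E, ℓ e)
        - (2 * Real.sqrt t / Real.sqrt Real.pi) * Fintype.card E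
        + 2 * Real.sqrt t * ∑ e : E, H (ℓ e / (2 * Real.sqrt t)) := by
  set c := 2 * Real.sqrt t with hc_def
  have hc : c ≠ 0 := (mul_pos two_pos (Real.sqrt_pos.2 ht)).ne'
  have hpi : Real.sqrt Real.pi ≠ 0 := (Real.sqrt_pos.2 Real.pi_pos).ne'
  have hc_sq : 4 * t = c ^ 2 := by
    rw [hc_def, mul_pow, Real.sq_sqrt ht.le]
    norm_num
  have hsqrt : Real.sqrt (4 * Real.pi * t) = c * Real.sqrt Real.pi := by
    rw [show 4 * Real.pi * t = c ^ 2 * Real.pi by rw [← hc_sq]; ring,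
      Real.sqrt_mul (sq_nonneg c), Real.sqrt_sq (by positivity)]
  have hmain : (1 / Real.sqrt (4 * Real.pi * t))
        * (∑ e : E, ∫ x in (0 : ℝ)..(ℓ e), ∫ y in (0 : ℝ)..(ℓ e),
            Real.exp (-(x - y) ^ 2 / (4 * t)))
      = (∑ e : E, ℓ e) - (c / Real.sqrt Real.pi) * Fintype.card E
        + c * ∑ e : E, H (ℓ e / c) := by
    simp_rw [hsqrt, hc_sq, integral_integral_exp_neg_sub_sq_div hc]
    rw [← Finset.mul_sum, ← mul_assoc, one_div_mul_cancel (mul_ne_zero hc hpi), one_mul,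
      Finset.sum_add_distrib, Finset.sum_sub_distrib, ← Finset.mul_sum, Finset.sum_const,
      Finset.card_univ, nsmul_eq_mul, mul_comm (Fintype.card E : ℝ)]
  refine ⟨?_, hmain⟩
  have hH (e : E) : c * H (ℓ e / c) =
      c / Real.sqrt Real.pi * Real.exp (-(ℓ e) ^ 2 / (4 * t)) - ℓ e * erfc (ℓ e / c) := by
    rw [H, hc_sq, show -(ℓ e) ^ 2 / c ^ 2 = -(ℓ e / c) ^ 2 by ring]
    field_simp
  rw [hmain, Finset.mul_sum, Finset.sum_congr rfl fun e _ => hH e, Finset.sum_sub_distrib,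
    ← Finset.mul_sum]
  ring
end

section
/- For all 0 < α < β one has lim_{t → 0⁺} (1/(2t)) · ∫_α^β ∫₀^α e^{−(x−y)²/(4t)} dy dx = 1. (Equivalently, (√π/√t)·(1/√(4πt))·∫_α^β ∫₀^α e^{−(x−y)²/(4t)} dy dx → 1 as t → 0⁺.) -/
open MeasureTheory Filter

/-- The unnormalized error function `∫₀ʷ e^{-u²} du`. -/
noncomputable def gaussPrimitive (w : ℝ) : ℝ := ∫ u in (0 : ℝ)..w, Real.exp (-u ^ 2)

/-- A primitive of `gaussPrimitive`, in closed form. -/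
noncomputable def gaussSecondPrimitive (w : ℝ) : ℝ :=
  w * gaussPrimitive w + Real.exp (-w ^ 2) / 2

theorem continuous_exp_neg_sq : Continuous fun u : ℝ => Real.exp (-u ^ 2) := by fun_prop

theorem hasDerivAt_exp_neg_sq (w : ℝ) :
    HasDerivAt (fun u : ℝ => Real.exp (-u ^ 2)) (-(2 * w) * Real.exp (-w ^ 2)) w := by
  have h := ((hasDerivAt_pow 2 w).fun_neg).exp
  convert h using 1
  simp
  ring

theorem hasDerivAt_gaussPrimitive (w : ℝ) :
    HasDerivAt gaussPrimitive (Real.exp (-w ^ 2)) w :=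
  continuous_exp_neg_sq.integral_hasStrictDerivAt 0 w |>.hasDerivAt

theorem continuous_gaussPrimitive : Continuous gaussPrimitive :=
  continuous_iff_continuousAt.2 fun w => (hasDerivAt_gaussPrimitive w).continuousAt

theorem hasDerivAt_gaussSecondPrimitive (w : ℝ) :
    HasDerivAt gaussSecondPrimitive (gaussPrimitive w) w := by
  have h := ((hasDerivAt_id w).fun_mul (hasDerivAt_gaussPrimitive w)).fun_add
    ((hasDerivAt_exp_neg_sq w).div_const 2)
  exact h.congr_deriv (by simp only [id]; ring)

theorem monotone_gaussPrimitive : Monotone gaussPrimitive :=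
  monotone_of_hasDerivAt_nonneg hasDerivAt_gaussPrimitive fun _ => (Real.exp_pos _).le

theorem tendsto_gaussPrimitive : Tendsto gaussPrimitive atTop (nhds (√Real.pi / 2)) := by
  have hi : IntegrableOn (fun u : ℝ => Real.exp (-u ^ 2)) (Set.Ioi 0) := by
    simpa using (integrable_exp_neg_mul_sq one_pos).integrableOn (s := Set.Ioi (0 : ℝ))
  have h := intervalIntegral_tendsto_integral_Ioi 0 hi tendsto_id
  have hv : ∫ u in Set.Ioi (0 : ℝ), Real.exp (-u ^ 2) = √Real.pi / 2 := by
    simpa using integral_gaussian_Ioi 1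
  rwa [hv] at h

theorem mul_gaussPrimitive_sub_le {w T : ℝ} (hT : w ≤ T) :
    w * (gaussPrimitive T - gaussPrimitive w) ≤ Real.exp (-w ^ 2) / 2 := by
  have hm : AntitoneOn (fun u => w * gaussPrimitive u + Real.exp (-u ^ 2) / 2) (Set.Ici w) := by
    have hd (u : ℝ) : HasDerivAt (fun u => w * gaussPrimitive u + Real.exp (-u ^ 2) / 2)
        (w * Real.exp (-u ^ 2) + -(2 * u) * Real.exp (-u ^ 2) / 2) u :=
      ((hasDerivAt_gaussPrimitive u).const_mul w).fun_add ((hasDerivAt_exp_neg_sq u).div_const 2)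
    refine antitoneOn_of_deriv_nonpos (convex_Ici w)
      (fun u _ => (hd u).continuousAt.continuousWithinAt)
      (fun u _ => (hd u).differentiableAt.differentiableWithinAt) fun u hu => ?_
    rw [interior_Ici, Set.mem_Ioi] at hu
    rw [(hd u).deriv]
    nlinarith [Real.exp_pos (-u ^ 2)]
  have h := hm Set.self_mem_Ici (Set.mem_Ici.2 hT) hT
  simp only at h
  linarith [Real.exp_pos (-T ^ 2)]

theorem tendsto_gaussSecondPrimitive_sub :
    Tendsto (fun w => gaussSecondPrimitive w - w * (√Real.pi / 2)) atTop (nhds 0) := by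
  have he : Tendsto (fun w : ℝ => Real.exp (-w ^ 2) / 2) atTop (nhds 0) := by
    have h := (Real.tendsto_exp_atBot.comp
      (tendsto_neg_atTop_atBot.comp (tendsto_pow_atTop (α := ℝ) two_ne_zero))).div_const 2
    simpa [Function.comp_def] using h
  refine tendsto_of_tendsto_of_tendsto_of_le_of_le' tendsto_const_nhds he ?_ ?_
  · refine Eventually.of_forall fun w => ?_
    have h : w * (√Real.pi / 2 - gaussPrimitive w) ≤ Real.exp (-w ^ 2) / 2 :=
      le_of_tendsto ((tendsto_gaussPrimitive.sub_const _).const_mul w)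
        ((eventually_ge_atTop w).mono fun T hT => mul_gaussPrimitive_sub_le hT)
    simp only [gaussSecondPrimitive]
    linarith
  · filter_upwards [eventually_ge_atTop 0] with w hw
    have h := mul_le_mul_of_nonneg_left
      (monotone_gaussPrimitive.ge_of_tendsto tendsto_gaussPrimitive w) hw
    simp only [gaussSecondPrimitive]
    linarith

theorem integral_exp_neg_sub_sq_div_s18 {s : ℝ} (hs : s ≠ 0) (x α : ℝ) :
    ∫ y in (0 : ℝ)..α, Real.exp (-(x - y) ^ 2 / s ^ 2) =
      s * gaussPrimitive (x / s) - s * gaussPrimitive ((x - α) / s) := by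
  have hd (y : ℝ) : HasDerivAt (fun y => -(s * gaussPrimitive ((x - y) / s)))
      (Real.exp (-(x - y) ^ 2 / s ^ 2)) y := by
    have h := (((hasDerivAt_gaussPrimitive ((x - y) / s)).comp y
      (((hasDerivAt_id y).const_sub x).div_const s)).const_mul s).fun_neg
    refine h.congr_deriv ?_
    rw [div_pow, neg_div]
    field_simp
  rw [intervalIntegral.integral_eq_sub_of_hasDerivAt (fun y _ => hd y)
    (Continuous.intervalIntegrable (by fun_prop) _ _), sub_zero]
  ring

theorem integral_integral_exp_neg_sub_sq_div_s18 {s : ℝ} (hs : s ≠ 0) (α β : ℝ) :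
    ∫ x in α..β, ∫ y in (0 : ℝ)..α, Real.exp (-(x - y) ^ 2 / s ^ 2) =
      s ^ 2 * (gaussSecondPrimitive (β / s) - gaussSecondPrimitive ((β - α) / s)
        - gaussSecondPrimitive (α / s) + 1 / 2) := by
  have hd (x : ℝ) : HasDerivAt
      (fun x => s ^ 2 * (gaussSecondPrimitive (x / s) - gaussSecondPrimitive ((x - α) / s)))
      (s * gaussPrimitive (x / s) - s * gaussPrimitive ((x - α) / s)) x := by
    have h := (((hasDerivAt_gaussSecondPrimitive (x / s)).comp x
      ((hasDerivAt_id x).div_const s)).fun_sub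
      ((hasDerivAt_gaussSecondPrimitive ((x - α) / s)).comp x
        (((hasDerivAt_id x).sub_const α).div_const s))).const_mul (s ^ 2)
    refine h.congr_deriv ?_
    field_simp
  have hc := continuous_gaussPrimitive
  simp only [integral_exp_neg_sub_sq_div_s18 hs]
  rw [intervalIntegral.integral_eq_sub_of_hasDerivAt (fun x _ => hd x)
    (Continuous.intervalIntegrable (by fun_prop) _ _)]
  have h0 : gaussSecondPrimitive 0 = 1 / 2 := by simp [gaussSecondPrimitive]
  rw [sub_self, zero_div, h0]
  ring

/-- For all `0 < α < β` one has
`lim_{t → 0⁺} (1/(2t)) ∫_α^β ∫₀^α e^{−(x−y)²/(4t)} dy dx = 1`. -/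
theorem boundary_heat_flow_limit (α β : ℝ) (hα : 0 < α) (hαβ : α < β) :
    Tendsto
      (fun t : ℝ =>
        (1 / (2 * t)) * ∫ x in α..β, ∫ y in (0 : ℝ)..α, Real.exp (-(x - y) ^ 2 / (4 * t)))
      (nhdsWithin 0 (Set.Ioi 0)) (nhds 1) := by
  have hs : Tendsto (fun t : ℝ => √(4 * t)) (nhdsWithin 0 (Set.Ioi 0))
      (nhdsWithin 0 (Set.Ioi 0)) := by
    refine tendsto_nhdsWithin_iff.2 ⟨?_, ?_⟩
    · have h : Continuous fun t : ℝ => √(4 * t) := by fun_prop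
      simpa using (h.tendsto 0).mono_left nhdsWithin_le_nhds
    · filter_upwards [self_mem_nhdsWithin] with t ht
      exact Real.sqrt_pos.2 (mul_pos four_pos ht)
  have hw {a : ℝ} (ha : 0 < a) : Tendsto (fun t : ℝ =>
      gaussSecondPrimitive (a / √(4 * t)) - a / √(4 * t) * (√Real.pi / 2))
      (nhdsWithin 0 (Set.Ioi 0)) (nhds 0) := by
    refine tendsto_gaussSecondPrimitive_sub.comp ?_
    simpa only [div_eq_mul_inv, Function.comp_def] using
      (tendsto_inv_nhdsGT_zero.comp hs).const_mul_atTop ha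
  have h := ((((hw (hα.trans hαβ)).sub (hw (sub_pos.2 hαβ))).sub (hw hα)).add_const
    (1 / 2)).const_mul 2
  rw [show (2 : ℝ) * (0 - 0 - 0 + 1 / 2) = 1 by norm_num] at h
  refine h.congr' ?_
  filter_upwards [self_mem_nhdsWithin] with t ht
  have ht' : (0 : ℝ) < t := ht
  have hsq : √(4 * t) ^ 2 = 4 * t := Real.sq_sqrt (by positivity)
  have hpos : √(4 * t) ≠ 0 := (Real.sqrt_pos.2 (by positivity)).ne'
  have key := integral_integral_exp_neg_sub_sq_div_s18 hpos α β
  rw [hsq] at key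
  rw [key]
  field_simp
  ring
end
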